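/- Let Γ ⊆ ℝⁿ be an open symmetric convex cone with vertex at the origin, ∂Γ ≠ ∅ and Γ_n ⊆ Γ ⊆ Γ_1. Then there exists a constant ϑ_Γ > 0 depending only on Γ such that: for every smooth symmetric concave function f : Γ → ℝ satisfying condition (1.8), every λ ∈ Γ, and every index i with λ_i ≤ 0, one has f_i(λ) ≥ ϑ_Γ Σ_{j=1}^n f_j(λ). -/

import Mathlib

open Filter

noncomputable section

/-- The `j`-th elementary symmetric polynomial of `lam : Fin n → ℝ`. -/
def esymmR (n j : ℕ) (lam : Fin n → ℝ) : ℝ :=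
  ∑ s ∈ Finset.univ.powersetCard j, ∏ i ∈ s, lam i

/-- The `k`-th Gårding cone `Γ_k ⊆ ℝⁿ`:
    `{λ : σ_j(λ) > 0 for all 1 ≤ j ≤ k}`. -/
def gardingCone (n k : ℕ) : Set (Fin n → ℝ) :=
  {lam | ∀ j, 1 ≤ j → j ≤ k → 0 < esymmR n j lam}

/-- `Γ` is an open symmetric convex cone with vertex at the origin,
    nonempty boundary, and `Γ_n ⊆ Γ ⊆ Γ_1`. -/
structure IsGoodCone (n : ℕ) (Γ : Set (Fin n → ℝ)) : Prop where
  isOpen : IsOpen Γ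
  symm : ∀ σ : Equiv.Perm (Fin n), ∀ lam ∈ Γ, (lam ∘ σ) ∈ Γ
  convex : Convex ℝ Γ
  cone : ∀ t : ℝ, 0 < t → ∀ lam ∈ Γ, t • lam ∈ Γ
  frontier_nonempty : (frontier Γ).Nonempty
  posCone_subset : gardingCone n n ⊆ Γ
  subset_cone_one : Γ ⊆ gardingCone n 1

/-- The partial derivative `f_i(λ) = ∂f/∂λ_i (λ)`. -/
def pder (n : ℕ) (f : (Fin n → ℝ) → ℝ) (i : Fin n) (lam : Fin n → ℝ) : ℝ :=
  deriv (fun t : ℝ => f (fun j => if j = i then lam j + t else lam j)) 0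

/-- `f` is smooth, symmetric and concave on `Γ`. -/
structure IsGoodF (n : ℕ) (Γ : Set (Fin n → ℝ)) (f : (Fin n → ℝ) → ℝ) : Prop where
  smooth : ContDiffOn ℝ (⊤ : ℕ∞) f Γ
  symm : ∀ σ : Equiv.Perm (Fin n), ∀ lam ∈ Γ, f (lam ∘ σ) = f lam
  concave : ConcaveOn ℝ Γ f

/-- Condition (1.8): for each `σ < sup_Γ f` and each `λ ∈ Γ`,
    `lim_{t → +∞} f(tλ) > σ`. -/
def Cond18 (n : ℕ) (Γ : Set (Fin n → ℝ)) (f : (Fin n → ℝ) → ℝ) : Prop :=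
  ∀ σ : ℝ, (∃ μ ∈ Γ, σ < f μ) → ∀ lam ∈ Γ, ∀ᶠ t : ℝ in atTop, σ < f (t • lam)

/-- Condition (1.9): `f_i ≥ 0` for all `i` and `Σ f_i > 0` on `Γ`. -/
def Cond19 (n : ℕ) (Γ : Set (Fin n → ℝ)) (f : (Fin n → ℝ) → ℝ) : Prop :=
  ∀ lam ∈ Γ, (∀ i, 0 ≤ pder n f i lam) ∧ 0 < ∑ i, pder n f i lam

/-- `κ_Γ`: the largest `l` such that some vector with exactly the first `l`
    entries negative (and the rest positive) belongs to `Γ`. -/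
def kappa (n : ℕ) (Γ : Set (Fin n → ℝ)) : ℕ :=
  sSup {l : ℕ | ∃ α : Fin n → ℝ, (∀ i, 0 < α i) ∧
    (fun i : Fin n => if (i : ℕ) < l then -α i else α i) ∈ Γ}

/-- `f` is of `m`-uniform ellipticity. -/
def UniformlyElliptic (n m : ℕ) (Γ : Set (Fin n → ℝ)) (f : (Fin n → ℝ) → ℝ) : Prop :=
  Cond19 n Γ f ∧ ∃ θ : ℝ, 0 < θ ∧ ∀ lam ∈ Γ, Monotone lam →
    ∀ i : Fin n, (i : ℕ) < m → θ * ∑ j, pder n f j lam ≤ pder n f i lam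


lemma aux_pder {n : ℕ} {f : (Fin n → ℝ) → ℝ} {lam : Fin n → ℝ} (hd : DifferentiableAt ℝ f lam)
    (i : Fin n) : pder n f i lam = fderiv ℝ f lam (Pi.single i 1) := by
  unfold pder
  have h1 : (fun t : ℝ => f (fun j => if j = i then lam j + t else lam j))
      = fun t : ℝ => f (lam + t • Pi.single i (1 : ℝ)) := by
    funext t
    congr 1
    funext j
    by_cases h : j = i
    · subst h; simp
    · simp [h]
  rw [h1]
  have h2 := hd.hasFDerivAt.hasLineDerivAt (Pi.single i (1 : ℝ))
  exact HasDerivAt.deriv h2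

lemma aux_sum {n : ℕ} {f : (Fin n → ℝ) → ℝ} {lam : Fin n → ℝ} (hd : DifferentiableAt ℝ f lam)
    (v : Fin n → ℝ) : fderiv ℝ f lam v = ∑ j, v j * pder n f j lam := by
  conv_lhs => rw [← Finset.univ_sum_single v]
  rw [map_sum]
  refine Finset.sum_congr rfl fun j _ => ?_
  rw [aux_pder hd, ← smul_eq_mul, ← map_smul]
  congr 1
  ext k
  by_cases h : k = j
  · subst h; simp
  · simp [h]

lemma aux_grad {n : ℕ} {Γ : Set (Fin n → ℝ)} {f : (Fin n → ℝ) → ℝ} (hc : ConcaveOn ℝ Γ f)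
    {lam mu : Fin n → ℝ} (hl : lam ∈ Γ) (hm : mu ∈ Γ) (hd : DifferentiableAt ℝ f lam) :
    f mu - f lam ≤ fderiv ℝ f lam (mu - lam) := by
  have h2 := hd.hasFDerivAt.hasLineDerivAt (mu - lam)
  have h3 := HasDerivAt.tendsto_slope_zero_right h2
  refine ge_of_tendsto h3 ?_
  have h4 : Set.Ioo (0 : ℝ) 1 ∈ nhdsWithin (0 : ℝ) (Set.Ioi 0) :=
    Ioo_mem_nhdsGT one_pos
  filter_upwards [h4] with t ht
  have h5 := hc.2 hl hm (by linarith [ht.2] : (0 : ℝ) ≤ 1 - t) ht.1.le (by ring)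
  have h6 : (1 - t) • lam + t • mu = lam + t • (mu - lam) := by
    ext k; simp; ring
  rw [h6] at h5
  simp only [smul_eq_mul, zero_add, zero_smul, add_zero] at h5 ⊢
  rw [inv_mul_eq_div, le_div_iff₀ ht.1]
  nlinarith

lemma aux_pos_mem {n : ℕ} {Γ : Set (Fin n → ℝ)} (hΓ : IsGoodCone n Γ) {v : Fin n → ℝ}
    (hv : ∀ i, 0 < v i) : v ∈ Γ := by
  apply hΓ.posCone_subset
  intro j _ hj
  unfold esymmR
  apply Finset.sum_pos
  · intro s _
    exact Finset.prod_pos fun i _ => hv i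
  · apply Finset.powersetCard_nonempty.2
    simpa using hj

lemma aux_nonneg {n : ℕ} {Γ : Set (Fin n → ℝ)} {f : (Fin n → ℝ) → ℝ} (hΓ : IsGoodCone n Γ)
    (hc : ConcaveOn ℝ Γ f) (h18 : Cond18 n Γ f)
    {lam mu : Fin n → ℝ} (hl : lam ∈ Γ) (hm : mu ∈ Γ) (hd : DifferentiableAt ℝ f lam) :
    0 ≤ fderiv ℝ f lam mu := by
  by_contra! hneg
  have h1 := h18 (f lam - 1) ⟨lam, hl, by linarith⟩ mu hm
  set a := fderiv ℝ f lam mu with ha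
  set b := fderiv ℝ f lam lam with hb
  obtain ⟨t, ht1, ht0, ht2⟩ := (h1.and ((eventually_gt_atTop (0 : ℝ)).and
    (eventually_ge_atTop ((b - 1) / a)))).exists
  have h2 := aux_grad hc hl (hΓ.cone t ht0 mu hm) hd
  rw [map_sub, map_smul, smul_eq_mul, ← ha, ← hb] at h2
  have h3 : t * a ≤ b - 1 := by
    rwa [div_le_iff_of_neg hneg] at ht2
  linarith

lemma aux_pder_nonneg {n : ℕ} {Γ : Set (Fin n → ℝ)} {f : (Fin n → ℝ) → ℝ} (hΓ : IsGoodCone n Γ)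
    (hc : ConcaveOn ℝ Γ f) (h18 : Cond18 n Γ f)
    {lam : Fin n → ℝ} (hl : lam ∈ Γ) (hd : DifferentiableAt ℝ f lam) (i : Fin n) :
    0 ≤ pder n f i lam := by
  rw [aux_pder hd]
  have key : ∀ e : ℝ, 0 < e → 0 ≤ fderiv ℝ f lam (Pi.single i 1) + e * fderiv ℝ f lam 1 := by
    intro e he
    have h := aux_nonneg hΓ hc h18 hl (mu := Pi.single i 1 + e • 1) (aux_pos_mem hΓ (by
      intro j
      have : (0 : ℝ) ≤ (Pi.single i (1 : ℝ) : Fin n → ℝ) j := by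
        by_cases h : j = i
        · subst h; simp
        · simp [h]
      simp only [Pi.add_apply, Pi.smul_apply, Pi.one_apply, smul_eq_mul, mul_one]
      linarith)) hd
    rwa [map_add, map_smul, smul_eq_mul] at h
  have h1 : 0 ≤ fderiv ℝ f lam 1 := aux_nonneg hΓ hc h18 hl (aux_pos_mem hΓ (by simp)) hd
  refine le_of_forall_pos_le_add fun e he => ?_
  have h2 := key (e / (fderiv ℝ f lam 1 + 1)) (by positivity)
  have h3 : e / (fderiv ℝ f lam 1 + 1) * fderiv ℝ f lam 1 ≤ e := by
    rw [div_mul_eq_mul_div, div_le_iff₀ (by positivity)]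
    nlinarith
  linarith

lemma aux_mono {n : ℕ} {Γ : Set (Fin n → ℝ)} {f : (Fin n → ℝ) → ℝ} (hΓ : IsGoodCone n Γ)
    (hf : IsGoodF n Γ f)
    {lam : Fin n → ℝ} (hl : lam ∈ Γ) (hd : DifferentiableAt ℝ f lam) {i j : Fin n}
    (hij : lam i < lam j) : pder n f j lam ≤ pder n f i lam := by
  have h1 := aux_grad hf.concave hl (hΓ.symm (Equiv.swap i j) lam hl) hd
  rw [hf.symm _ _ hl, sub_self] at h1
  have h2 : lam ∘ (Equiv.swap i j) - lam
      = (lam j - lam i) • (Pi.single i (1 : ℝ) - Pi.single j (1 : ℝ)) := by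
    have hne : i ≠ j := by rintro rfl; exact lt_irrefl _ hij
    ext k
    by_cases hki : k = i
    · subst hki; simp [hne]
    · by_cases hkj : k = j
      · subst hkj; simp [hki]
      · simp [hki, hkj, Equiv.swap_apply_of_ne_of_ne hki hkj]
  rw [h2, map_smul, map_sub, smul_eq_mul, ← aux_pder hd, ← aux_pder hd] at h1
  have := nonneg_of_mul_nonneg_right h1 (by linarith : 0 < lam j - lam i)
  linarith

lemma aux_shift {n : ℕ} {Γ : Set (Fin n → ℝ)} (hΓ : IsGoodCone n Γ)
    {lam : Fin n → ℝ} (hl : lam ∈ Γ) : ∃ mu ∈ Γ, ∀ i, lam i ≤ 0 → mu i < 0 := by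
  have hcont : Continuous fun e : ℝ => (fun i => lam i - e : Fin n → ℝ) := by fun_prop
  have h1 : ∀ᶠ e : ℝ in nhds 0, (fun i => lam i - e : Fin n → ℝ) ∈ Γ := by
    apply hcont.continuousAt.eventually_mem
    apply hΓ.isOpen.mem_nhds
    simpa using hl
  obtain ⟨e, he, he0⟩ := ((h1.filter_mono nhdsWithin_le_nhds).and
    (self_mem_nhdsWithin (s := Set.Ioi (0 : ℝ)))).exists
  refine ⟨_, he, fun i hi => ?_⟩
  have : 0 < e := he0
  linarith

lemma aux_S (n : ℕ) (Γ : Set (Fin n → ℝ)) (hΓ : IsGoodCone n Γ) (S : Finset (Fin n)) :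
    ∃ ϑ : ℝ, 0 < ϑ ∧ ∀ f : (Fin n → ℝ) → ℝ, IsGoodF n Γ f → Cond18 n Γ f →
      ∀ lam ∈ Γ, (∀ i, i ∈ S ↔ lam i ≤ 0) → ∀ i ∈ S,
        ϑ * ∑ j, pder n f j lam ≤ pder n f i lam := by
  by_cases hS : ∃ mu ∈ Γ, ∀ i ∈ S, mu i < 0
  swap
  · refine ⟨1, one_pos, fun f _ _ lam hl hSl => ?_⟩
    obtain ⟨mu, hm, hmu⟩ := aux_shift hΓ hl
    exact absurd ⟨mu, hm, fun i hi => hmu i ((hSl i).1 hi)⟩ hS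
  obtain ⟨mu, hm, hmu⟩ := hS
  set A := ∑ j, |mu j| with hA
  have hA0 : 0 ≤ A := Finset.sum_nonneg fun j _ => abs_nonneg _
  -- bound constants
  set C := ∑ j, (1 + A / |mu j|) with hC
  have hC0 : 0 ≤ C := Finset.sum_nonneg fun j _ => by positivity
  refine ⟨1 / (C + 1), by positivity, fun f hf h18 lam hl hSl i hi => ?_⟩
  have hd : DifferentiableAt ℝ f lam :=
    (hf.smooth.contDiffAt (hΓ.isOpen.mem_nhds hl)).differentiableAt (by simp)
  have hp := aux_pder_nonneg hΓ hf.concave h18 hl hd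
  set p := fun j => pder n f j lam with hpdef
  have hpos : ∀ j, 0 ≤ p j := hp
  have hle : ∀ j, j ∉ S → p j ≤ p i := by
    intro j hj
    apply aux_mono hΓ hf hl hd
    have h1 := (hSl i).1 hi
    have h2 := mt (hSl j).2 hj
    linarith
  have hgrad : 0 ≤ ∑ j, mu j * p j := by
    have := aux_nonneg hΓ hf.concave h18 hl hm hd
    rwa [aux_sum hd] at this
  have hk : ∀ k ∈ S, |mu k| * p k ≤ A * p i := by
    intro k hk
    have h1 : |mu k| * p k + ∑ j, mu j * p j ≤ A * p i := by
      rw [hA, Finset.sum_mul, ← Finset.add_sum_erase _ _ (Finset.mem_univ k),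
        ← Finset.add_sum_erase _ (fun j => |mu j| * p i) (Finset.mem_univ k), ← add_assoc]
      apply add_le_add
      · rw [abs_of_neg (hmu k hk)]
        nlinarith [hmu k hk, hpos i, mul_nonneg (neg_nonneg.2 (hmu k hk).le) (hpos i)]
      · refine Finset.sum_le_sum fun j _ => ?_
        by_cases hj : j ∈ S
        · have h3 := mul_nonneg (neg_nonneg.2 (hmu j hj).le) (hpos j)
          have h4 := mul_nonneg (abs_nonneg (mu j)) (hpos i)
          linarith
        · exact mul_le_mul (le_abs_self _) (hle j hj) (hpos j) (abs_nonneg _)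
    linarith
  have hall : ∀ j, p j ≤ (1 + A / |mu j|) * p i := by
    intro j
    by_cases hj : j ∈ S
    · have h0 : 0 < |mu j| := abs_pos.2 (hmu j hj).ne
      have h1 : p j ≤ A / |mu j| * p i := by
        rw [div_mul_eq_mul_div, le_div_iff₀ h0]
        linarith [hk j hj]
      linarith [hpos i]
    · have h1 := hle j hj
      have h2 : 0 ≤ A / |mu j| * p i := mul_nonneg (by positivity) (hpos i)
      linarith
  have hsum : ∑ j, p j ≤ C * p i := by
    rw [hC, Finset.sum_mul]
    exact Finset.sum_le_sum fun j _ => hall j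
  change 1 / (C + 1) * ∑ j, p j ≤ p i
  rw [div_mul_eq_mul_div, one_mul, div_le_iff₀ (by positivity)]
  linarith [hpos i]

/-- Corollary 2.4: inequality (1.14) holds with a constant `ϑ_Γ > 0` depending
only on `Γ`: `f_i(λ) ≥ ϑ_Γ Σ_j f_j(λ)` whenever `λ_i ≤ 0`. -/
theorem stmt_5 (n : ℕ) (hn : 2 ≤ n) (Γ : Set (Fin n → ℝ)) (hΓ : IsGoodCone n Γ) :
    ∃ ϑ : ℝ, 0 < ϑ ∧ ∀ f : (Fin n → ℝ) → ℝ, IsGoodF n Γ f → Cond18 n Γ f →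
      ∀ lam ∈ Γ, ∀ i : Fin n, lam i ≤ 0 →
        ϑ * ∑ j, pder n f j lam ≤ pder n f i lam := by
  choose θ hθ0 hθ using aux_S n Γ hΓ
  refine ⟨Finset.univ.inf' Finset.univ_nonempty θ, ?_, ?_⟩
  · rw [Finset.lt_inf'_iff]
    exact fun S _ => hθ0 S
  intro f hf h18 lam hl i hi
  have hd : DifferentiableAt ℝ f lam :=
    (hf.smooth.contDiffAt (hΓ.isOpen.mem_nhds hl)).differentiableAt (by simp)
  have h1 := hθ (Finset.univ.filter fun j => lam j ≤ 0) f hf h18 lam hl (by simp) i (by simpa)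
  refine le_trans (mul_le_mul_of_nonneg_right (Finset.inf'_le _ (Finset.mem_univ _)) ?_) h1
  exact Finset.sum_nonneg fun j _ => aux_pder_nonneg hΓ hf.concave h18 hl hd j

end
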